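/- Let A be a complex unital Banach algebra, let H, D ∈ A, δ > 0, and suppose: (i) ‖exp(u•H)‖ ≤ 1, ‖exp(u•D)‖ ≤ 1 and ‖exp(u•(H + D))‖ ≤ 1 for every u ∈ [0, δ]; (ii) (‖H‖/2 + ‖D‖)·δ ≤ 1; and (iii) K, N ∈ A satisfy ‖K‖ ≤ 1 and ‖N‖ ≤ 1. Set ε_H = ‖exp((δ/2)•H) − K‖ and ε_D = ‖exp(δ•D) − N‖. Then ‖exp(δ•(H + D)) − K * N * K‖ ≤ (‖H*D − D*H‖/3)·(‖H‖/2 + ‖D‖)·δ³ + 2·ε_H + ε_D. -/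

import Mathlib

open NormedSpace

section GadgetLemmas

variable {A : Type*} [NormedRing A]

lemma norm_mul_sub_one_le {p q : A} (hq : ‖q‖ ≤ 1) :
    ‖p * q - 1‖ ≤ ‖p - 1‖ + ‖q - 1‖ := by
  have e : p * q - 1 = (p - 1) * q + (q - 1) := by noncomm_ring
  rw [e]
  refine (norm_add_le _ _).trans (add_le_add ?_ le_rfl)
  exact (norm_mul_le _ _).trans (mul_le_of_le_one_right (norm_nonneg _) hq)

lemma norm_mul_mul_sub_self_le {p q : A} (c : A) (hq : ‖q‖ ≤ 1) :
    ‖p * c * q - c‖ ≤ ‖c‖ * (‖p - 1‖ + ‖q - 1‖) := by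
  have e : p * c * q - c = (p - 1) * c * q + c * (q - 1) := by noncomm_ring
  rw [e]
  calc ‖(p - 1) * c * q + c * (q - 1)‖
      ≤ ‖(p - 1) * c * q‖ + ‖c * (q - 1)‖ := norm_add_le _ _
    _ ≤ ‖p - 1‖ * ‖c‖ + ‖c‖ * ‖q - 1‖ := by
      gcongr
      · exact (norm_mul_le _ _).trans
          ((mul_le_of_le_one_right (norm_nonneg _) hq).trans (norm_mul_le _ _))
      · exact norm_mul_le _ _
    _ = ‖c‖ * (‖p - 1‖ + ‖q - 1‖) := by ring

lemma norm_mul_mul_sub_mul_mul_le {p q k n : A} (hp : ‖p‖ ≤ 1) (hq : ‖q‖ ≤ 1)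
    (hk : ‖k‖ ≤ 1) (hn : ‖n‖ ≤ 1) :
    ‖p * q * p - k * n * k‖ ≤ 2 * ‖p - k‖ + ‖q - n‖ := by
  have e : p * q * p - k * n * k
      = (p - k) * (q * p) + k * (q - n) * p + k * n * (p - k) := by noncomm_ring
  have hqp : ‖q * p‖ ≤ 1 := (norm_mul_le _ _).trans (mul_le_one₀ hq (norm_nonneg _) hp)
  have hkn : ‖k * n‖ ≤ 1 := (norm_mul_le _ _).trans (mul_le_one₀ hk (norm_nonneg _) hn)
  have h₁ : ‖(p - k) * (q * p)‖ ≤ ‖p - k‖ :=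
    (norm_mul_le _ _).trans (mul_le_of_le_one_right (norm_nonneg _) hqp)
  have h₂ : ‖k * (q - n) * p‖ ≤ ‖q - n‖ :=
    ((norm_mul_le _ _).trans (mul_le_of_le_one_right (norm_nonneg _) hp)).trans
      ((norm_mul_le _ _).trans (mul_le_of_le_one_left (norm_nonneg _) hk))
  have h₃ : ‖k * n * (p - k)‖ ≤ ‖p - k‖ :=
    (norm_mul_le _ _).trans (mul_le_of_le_one_left (norm_nonneg _) hkn)
  rw [e]
  linarith [norm_add₃_le (a := (p - k) * (q * p)) (b := k * (q - n) * p) (c := k * n * (p - k))]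

variable [NormedAlgebra ℝ A] [CompleteSpace A]

lemma hasDerivAt_exp_sub_smul (x : A) (t s : ℝ) :
    HasDerivAt (fun s : ℝ => exp ((t - s) • x)) (-(exp ((t - s) • x) * x)) s := by
  simpa [Function.comp_def] using (hasDerivAt_exp_smul_const x (t - s)).scomp s
    ((hasDerivAt_id s).const_sub t)

lemma hasDerivAt_exp_smul_mul_mul_exp_sub_smul (x c : A) (t s : ℝ) :
    HasDerivAt (fun s : ℝ => exp (s • x) * c * exp ((t - s) • x))
      (exp (s • x) * (x * c - c * x) * exp ((t - s) • x)) s := by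
  have hcomm : exp ((t - s) • x) * x = x * exp ((t - s) • x) :=
    (((Commute.refl x).smul_left (t - s)).exp_left).eq
  convert! ((hasDerivAt_exp_smul_const x s).mul_const c).mul
    (hasDerivAt_exp_sub_smul x t s) using 1
  rw [hcomm]
  noncomm_ring

lemma norm_exp_smul_sub_one_le {x : A} {t : ℝ}
    (h : ∀ u ∈ Set.Icc (0 : ℝ) t, ‖exp (u • x)‖ ≤ 1) {u : ℝ} (hu : u ∈ Set.Icc (0 : ℝ) t) :
    ‖exp (u • x) - 1‖ ≤ ‖x‖ * u := by
  have := norm_image_sub_le_of_norm_deriv_le_segment' (f := fun s : ℝ => exp (s • x))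
    (C := ‖x‖) (a := 0) (b := t)
    (fun s _ => (hasDerivAt_exp_smul_const x s).hasDerivWithinAt)
    (fun s hs => (norm_mul_le _ _).trans
      (mul_le_of_le_one_left (norm_nonneg _) (h s ⟨hs.1, hs.2.le⟩))) u hu
  simpa using this

/-- The local defect of the symmetric splitting `exp (t • x) * exp (t • y) * exp (t • x)` is of
second order in `t`. -/
lemma norm_strang_defect_le {x y : A} {t : ℝ} (ht : 0 ≤ t)
    (hx : ∀ u ∈ Set.Icc (0 : ℝ) t, ‖exp (u • x)‖ ≤ 1)
    (hy : ∀ u ∈ Set.Icc (0 : ℝ) t, ‖exp (u • y)‖ ≤ 1) :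
    ‖(exp (t • x) * y - y * exp (t • x)) * exp (t • y)
        + exp (t • x) * (exp (t • y) * x - x * exp (t • y))‖
      ≤ 2 * ‖x * y - y * x‖ * (‖x‖ + ‖y‖) * t ^ 2 := by
  set c := x * y - y * x with hc
  have htt : t ∈ Set.Icc (0 : ℝ) t := ⟨ht, le_rfl⟩
  have key := norm_image_sub_le_of_norm_deriv_le_segment'
    (f := fun s : ℝ => exp (s • x) * y * exp ((t - s) • x) * exp (t • y)
      + exp (t • x) * (exp (s • y) * x * exp ((t - s) • y)))
    (C := 2 * ‖c‖ * (‖x‖ + ‖y‖) * t) (a := 0) (b := t)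
    (fun s _ => (((hasDerivAt_exp_smul_mul_mul_exp_sub_smul x y t s).mul_const
      (exp (t • y))).add ((hasDerivAt_exp_smul_mul_mul_exp_sub_smul y x t s).const_mul
      (exp (t • x)))).hasDerivWithinAt)
    (fun s hs => ?_) t htt
  · refine le_trans (le_of_eq ?_) (key.trans_eq (by ring))
    congr 1
    simp only [zero_smul, sub_zero, sub_self, exp_zero]
    noncomm_ring
  · have hs₁ : s ∈ Set.Icc (0 : ℝ) t := ⟨hs.1, hs.2.le⟩
    have hs₂ : t - s ∈ Set.Icc (0 : ℝ) t := ⟨by linarith [hs.2], by linarith [hs.1]⟩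
    have hq : ‖exp ((t - s) • x) * exp (t • y)‖ ≤ 1 :=
      (norm_mul_le _ _).trans (mul_le_one₀ (hx _ hs₂) (norm_nonneg _) (hy _ htt))
    have hX := norm_mul_mul_sub_self_le (p := exp (s • x)) c hq
    have hY := norm_mul_mul_sub_self_le (p := exp (t • x) * exp (s • y)) c (hy _ hs₂)
    have hX' := norm_mul_sub_one_le (p := exp ((t - s) • x)) (hy _ htt)
    have hY' := norm_mul_sub_one_le (p := exp (t • x)) (hy _ hs₁)
    have b₁ := norm_exp_smul_sub_one_le hx hs₁
    have b₂ := norm_exp_smul_sub_one_le hx hs₂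
    have b₃ := norm_exp_smul_sub_one_le hx htt
    have b₄ := norm_exp_smul_sub_one_le hy hs₁
    have b₅ := norm_exp_smul_sub_one_le hy hs₂
    have b₆ := norm_exp_smul_sub_one_le hy htt
    have e : exp (s • x) * c * exp ((t - s) • x) * exp (t • y)
        + exp (t • x) * (exp (s • y) * (y * x - x * y) * exp ((t - s) • y))
        = (exp (s • x) * c * (exp ((t - s) • x) * exp (t • y)) - c)
          - (exp (t • x) * exp (s • y) * c * exp ((t - s) • y) - c) := by
      rw [hc]; noncomm_ring
    rw [e]
    calc _ ≤ _ := norm_sub_le _ _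
      _ ≤ ‖c‖ * ((‖x‖ + ‖y‖) * t) + ‖c‖ * ((‖x‖ + ‖y‖) * t) := by
        refine add_le_add (hX.trans ?_) (hY.trans ?_) <;>
          exact mul_le_mul_of_nonneg_left (by linarith) (norm_nonneg _)
      _ = _ := by ring

lemma norm_exp_sub_strang_le {x y : A} {δ : ℝ} (hδ : 0 ≤ δ)
    (hx : ∀ u ∈ Set.Icc (0 : ℝ) δ, ‖exp (u • x)‖ ≤ 1)
    (hy : ∀ u ∈ Set.Icc (0 : ℝ) δ, ‖exp (u • y)‖ ≤ 1)
    (hxy : ∀ u ∈ Set.Icc (0 : ℝ) δ, ‖exp (u • (x + x + y))‖ ≤ 1) :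
    ‖exp (δ • (x + x + y)) - exp (δ • x) * exp (δ • y) * exp (δ • x)‖
      ≤ 2 / 3 * ‖x * y - y * x‖ * (‖x‖ + ‖y‖) * δ ^ 3 := by
  set M := ‖x * y - y * x‖ * (‖x‖ + ‖y‖) with hM
  set L := x + x + y with hL
  have hder (t : ℝ) : HasDerivAt
      (fun t : ℝ => exp ((δ - t) • L) * (exp (t • x) * exp (t • y) * exp (t • x))
        - exp (δ • L))
      (exp ((δ - t) • L) * (((exp (t • x) * y - y * exp (t • x)) * exp (t • y)
        + exp (t • x) * (exp (t • y) * x - x * exp (t • y))) * exp (t • x))) t := by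
    have hcx : exp (t • x) * x = x * exp (t • x) :=
      (((Commute.refl x).smul_left t).exp_left).eq
    have hx' : HasDerivAt (fun t : ℝ => exp (t • x)) (x * exp (t • x)) t :=
      hasDerivAt_exp_smul_const' x t
    have hy' : HasDerivAt (fun t : ℝ => exp (t • y)) (y * exp (t • y)) t :=
      hasDerivAt_exp_smul_const' y t
    refine (((hasDerivAt_exp_sub_smul L δ t).mul
      ((hx'.mul hy').mul hx')).sub_const _).congr_deriv ?_
    have hcx' (z : A) : exp (t • x) * (x * z) = x * (exp (t • x) * z) := by
      rw [← mul_assoc, hcx, mul_assoc]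
    simp only [Pi.mul_apply, hL, mul_add, add_mul, mul_sub, sub_mul, neg_mul, mul_assoc, hcx']
    abel
  have key := image_norm_le_of_norm_deriv_right_le_deriv_boundary
    (a := 0) (b := δ) (B := fun t : ℝ => 2 / 3 * M * t ^ 3)
    (B' := fun t : ℝ => 2 * M * t ^ 2)
    (fun t _ => (hder t).continuousAt.continuousWithinAt)
    (fun t _ => (hder t).hasDerivWithinAt) (by simp)
    (fun t => ((hasDerivAt_pow 3 t).const_mul (2 / 3 * M)).congr_deriv (by norm_num; ring))
    (fun t ht => ?_) (x := δ) ⟨hδ, le_rfl⟩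
  · rw [norm_sub_rev]
    simpa [hM, mul_assoc] using key
  · have ht₁ : t ∈ Set.Icc (0 : ℝ) δ := ⟨ht.1, ht.2.le⟩
    have ht₂ : δ - t ∈ Set.Icc (0 : ℝ) δ := ⟨by linarith [ht.2], by linarith [ht.1]⟩
    have hR := norm_strang_defect_le ht.1
      (fun u hu => hx u ⟨hu.1, hu.2.trans ht₁.2⟩) (fun u hu => hy u ⟨hu.1, hu.2.trans ht₁.2⟩)
    refine (norm_mul_le _ _).trans ((mul_le_of_le_one_left (norm_nonneg _) (hxy _ ht₂)).trans ?_)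
    refine (norm_mul_le _ _).trans ((mul_le_of_le_one_right (norm_nonneg _) (hx _ ht₁)).trans ?_)
    exact hR.trans_eq (by rw [hM]; ring)

end GadgetLemmas

theorem single_gadget_error_bound {A : Type*} [NormedRing A] [NormedAlgebra ℂ A]
    [CompleteSpace A] (H D : A) (δ : ℝ) (hδ : 0 < δ)
    (hH : ∀ u ∈ Set.Icc (0 : ℝ) δ, ‖exp (u • H)‖ ≤ 1)
    (hD : ∀ u ∈ Set.Icc (0 : ℝ) δ, ‖exp (u • D)‖ ≤ 1)
    (hHD : ∀ u ∈ Set.Icc (0 : ℝ) δ, ‖exp (u • (H + D))‖ ≤ 1)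
    (hnorm : (‖H‖ / 2 + ‖D‖) * δ ≤ 1)
    (K N : A) (hK : ‖K‖ ≤ 1) (hN : ‖N‖ ≤ 1) :
    ‖exp (δ • (H + D)) - K * N * K‖
      ≤ (‖H * D - D * H‖ / 3) * (‖H‖ / 2 + ‖D‖) * δ ^ 3 +
        2 * ‖exp ((δ / 2) • H) - K‖ + ‖exp (δ • D) - N‖ := by
  set x : A := (1 / 2 : ℝ) • H with hx
  have hxx : x + x + D = H + D := by
    rw [hx, ← add_smul]; norm_num
  have hux (u : ℝ) : u • x = (u / 2) • H := by
    rw [hx, smul_smul]; congr 1; ring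
  have hxc : ∀ u ∈ Set.Icc (0 : ℝ) δ, ‖exp (u • x)‖ ≤ 1 := fun u hu => by
    rw [hux]; exact hH _ ⟨by linarith [hu.1], by linarith [hu.1, hu.2]⟩
  have hxn : ‖x‖ = ‖H‖ / 2 := by
    rw [hx, norm_smul]; norm_num; ring
  have hcn : ‖x * D - D * x‖ = ‖H * D - D * H‖ / 2 := by
    rw [hx, smul_mul_assoc, mul_smul_comm, ← smul_sub, norm_smul]; norm_num; ring
  have hδδ : δ ∈ Set.Icc (0 : ℝ) δ := ⟨hδ.le, le_rfl⟩
  have h₁ := norm_exp_sub_strang_le hδ.le hxc hD (by rwa [hxx])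
  have h₂ := norm_mul_mul_sub_mul_mul_le (hxc δ hδδ) (hD δ hδδ) hK hN
  rw [hxx, hxn, hcn] at h₁
  rw [← hux]
  have h₃ := norm_sub_le_norm_sub_add_norm_sub (exp (δ • (H + D)))
    (exp (δ • x) * exp (δ • D) * exp (δ • x)) (K * N * K)
  linarith
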